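/- arXiv:1111.5146 — 2 statements merged into one kernel-verified Lean document; each statement's English description precedes it below -/
import Mathlib

section
/- Let R be a commutative noetherian unital ring, D a quiver, and T a representation of D into finitely generated R-modules. Then there exist an R-linear abelian category C(T), a representation T̃ : D → C(T), and a faithful, exact, R-linear functor ff_T : C(T) → R-Mod such that: (1) ff_T ∘ T̃ = T; and (2) for every R-linear abelian category A equipped with a faithful, exact, R-linear functor f : A → R-Mod and a representation F : D → A satisfying f ∘ F = T, there exists a faithful, exact, R-linear functor L(F) : C(T) → A, unique up to natural isomorphism, such that L(F) ∘ T̃ is isomorphic to F and f ∘ L(F) is naturally isomorphic to ff_T. -/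
open CategoryTheory CategoryTheory.Limits

universe b a u v w b2 a2

/-- A bundled `R`-linear abelian category. -/
structure RLinCat.{β, α, ρ} (R : Type ρ) [CommRing R] where
  /-- the underlying type of objects -/
  carrier : Type α
  [cat : Category.{β} carrier]
  [abelian : Abelian carrier]
  [linear : CategoryTheory.Linear R carrier]

attribute [instance] RLinCat.cat RLinCat.abelian RLinCat.linear

/-- A functor between `R`-linear (preadditive) categories is faithful, exact
(preserves finite limits and finite colimits) and `R`-linear. -/
def IsFEL (R : Type u) [CommRing R] {C : Type*} {D : Type*} [Category C] [Category D]
    [Preadditive C] [Preadditive D]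
    [CategoryTheory.Linear R C] [CategoryTheory.Linear R D] (F : C ⥤ D) : Prop :=
  F.Faithful ∧ PreservesFiniteLimits F ∧ PreservesFiniteColimits F ∧
    F.Additive ∧ (∀ [F.Additive], F.Linear R)

/-- Two representations (prefunctors) of a quiver in a category are isomorphic:
there is a family of isomorphisms between their values compatible with all edges. -/
def PrefunctorIso {D : Type*} [Quiver D] {A : Type*} [Category A] (F G : D ⥤q A) : Prop :=
  ∃ e : ∀ p : D, F.obj p ≅ G.obj p,
    ∀ ⦃p q : D⦄ (m : p ⟶ q), F.map m ≫ (e q).hom = (e p).hom ≫ G.map m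

namespace Nori

section Definable

variable {R : Type u} [CommRing R] {D : Type v} [Quiver.{w} D] (T : D ⥤q ModuleCat.{u} R)

/-- Formal finite direct sums of vertices, indexed by their realization as a module. -/
inductive Ctx : (M : Type u) → [AddCommGroup M] → [Module R M] → Type (max (u + 1) v)
  | zero : Ctx PUnit.{u + 1}
  | vertex (p : D) : Ctx (T.obj p)
  | prod {M N : Type u} [AddCommGroup M] [Module R M] [AddCommGroup N] [Module R N] :
      Ctx M → Ctx N → Ctx (M × N)

variable {T}

/-- Linear maps between contexts generated by the edges of the quiver. -/
inductive Basic : ∀ {M N : Type u} [AddCommGroup M] [Module R M] [AddCommGroup N] [Module R N],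
    Ctx T M → Ctx T N → (M →ₗ[R] N) → Prop
  | id {M : Type u} [AddCommGroup M] [Module R M] (c : Ctx T M) : Basic c c LinearMap.id
  | comp {M N K : Type u} [AddCommGroup M] [Module R M] [AddCommGroup N] [Module R N]
      [AddCommGroup K] [Module R K] {c : Ctx T M} {d : Ctx T N} {e : Ctx T K}
      {s : M →ₗ[R] N} {t : N →ₗ[R] K} : Basic c d s → Basic d e t → Basic c e (t ∘ₗ s)
  | fst {M N : Type u} [AddCommGroup M] [Module R M] [AddCommGroup N] [Module R N]
      (c : Ctx T M) (d : Ctx T N) : Basic (c.prod d) c (LinearMap.fst R M N)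
  | snd {M N : Type u} [AddCommGroup M] [Module R M] [AddCommGroup N] [Module R N]
      (c : Ctx T M) (d : Ctx T N) : Basic (c.prod d) d (LinearMap.snd R M N)
  | pair {M N K : Type u} [AddCommGroup M] [Module R M] [AddCommGroup N] [Module R N]
      [AddCommGroup K] [Module R K] {c : Ctx T M} {d : Ctx T N} {e : Ctx T K}
      {s : M →ₗ[R] N} {t : M →ₗ[R] K} :
      Basic c d s → Basic c e t → Basic c (d.prod e) (s.prod t)
  | zero {M N : Type u} [AddCommGroup M] [Module R M] [AddCommGroup N] [Module R N]
      (c : Ctx T M) (d : Ctx T N) : Basic c d 0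
  | add {M N : Type u} [AddCommGroup M] [Module R M] [AddCommGroup N] [Module R N]
      {c : Ctx T M} {d : Ctx T N} {s t : M →ₗ[R] N} :
      Basic c d s → Basic c d t → Basic c d (s + t)
  | smul {M N : Type u} [AddCommGroup M] [Module R M] [AddCommGroup N] [Module R N]
      {c : Ctx T M} {d : Ctx T N} (r : R) {s : M →ₗ[R] N} :
      Basic c d s → Basic c d (r • s)
  | edge {p q : D} (m : p ⟶ q) : Basic (Ctx.vertex p) (Ctx.vertex q) (T.map m).hom

/-- Definable submodules of contexts. -/
inductive Dfn : ∀ {M : Type u} [AddCommGroup M] [Module R M], Ctx T M → Submodule R M → Prop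
  | top {M : Type u} [AddCommGroup M] [Module R M] (c : Ctx T M) : Dfn c ⊤
  | bot {M : Type u} [AddCommGroup M] [Module R M] (c : Ctx T M) : Dfn c ⊥
  | inf {M : Type u} [AddCommGroup M] [Module R M] {c : Ctx T M} {A B : Submodule R M} :
      Dfn c A → Dfn c B → Dfn c (A ⊓ B)
  | map {M N : Type u} [AddCommGroup M] [Module R M] [AddCommGroup N] [Module R N]
      {c : Ctx T M} {d : Ctx T N} {s : M →ₗ[R] N} {A : Submodule R M} :
      Basic c d s → Dfn c A → Dfn d (A.map s)
  | comap {M N : Type u} [AddCommGroup M] [Module R M] [AddCommGroup N] [Module R N]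
      {c : Ctx T M} {d : Ctx T N} {s : M →ₗ[R] N} {A : Submodule R N} :
      Basic c d s → Dfn d A → Dfn c (A.comap s)

theorem Dfn.sup {M : Type u} [AddCommGroup M] [Module R M] {c : Ctx T M} {A B : Submodule R M}
    (hA : Dfn c A) (hB : Dfn c B) : Dfn c (A ⊔ B) := by
  have h := Dfn.map ((Basic.fst c c).add (Basic.snd c c))
    ((Dfn.comap (Basic.fst c c) hA).inf (Dfn.comap (Basic.snd c c) hB))
  convert h using 1
  ext x
  simp only [Submodule.mem_sup, Submodule.mem_map, Submodule.mem_inf, Submodule.mem_comap,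
    Prod.exists, LinearMap.add_apply, LinearMap.fst_apply, LinearMap.snd_apply]
  constructor
  · rintro ⟨y, hy, z, hz, e⟩
    exact ⟨y, z, ⟨hy, hz⟩, e⟩
  · rintro ⟨y, z, ⟨hy, hz⟩, e⟩
    exact ⟨y, hy, z, hz, e⟩

variable (T) in
/-- A presentation of a module as a definable subquotient of a context. -/
structure Pres (M : Type u) [AddCommGroup M] [Module R M] : Type (max (u + 1) v) where
  /-- the context -/
  W : Type u
  [grp : AddCommGroup W]
  [mod : Module R W]
  /-- the context -/
  c : Ctx T W
  /-- the graph of the partial surjection from the context -/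
  rel : Submodule R (W × M)
  sv : ∀ m, (0, m) ∈ rel → m = 0
  surj : ∀ m, ∃ x, (x, m) ∈ rel
  hdom : Dfn c (rel.map (LinearMap.fst R W M))
  hker : Dfn c (rel.comap (LinearMap.inl R W M))

attribute [instance] Pres.grp Pres.mod

section

variable {M N K : Type u} [AddCommGroup M] [Module R M] [AddCommGroup N] [Module R N]
  [AddCommGroup K] [Module R K] (P : Pres T M) (Q : Pres T N) (S : Pres T K)

variable {P} in
theorem Pres.sv2 {x : P.W} {m m' : M} (h : (x, m) ∈ P.rel) (h' : (x, m') ∈ P.rel) : m = m' := by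
  have := P.sv (m - m') (by simpa using P.rel.sub_mem h h')
  exact sub_eq_zero.1 this

/-- Preimage of a submodule in the context. -/
def Pres.pull (A : Submodule R M) : Submodule R P.W :=
  (P.rel ⊓ A.comap (LinearMap.snd R P.W M)).map (LinearMap.fst R P.W M)

theorem Pres.mem_pull {A : Submodule R M} {x : P.W} :
    x ∈ P.pull A ↔ ∃ m ∈ A, (x, m) ∈ P.rel := by
  simp only [Pres.pull, Submodule.mem_map, Submodule.mem_inf, Submodule.mem_comap, Prod.exists,
    LinearMap.fst_apply, LinearMap.snd_apply]
  constructor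
  · rintro ⟨y, m, ⟨h, h'⟩, rfl⟩
    exact ⟨m, h', h⟩
  · rintro ⟨m, h', h⟩
    exact ⟨x, m, ⟨h, h'⟩, rfl⟩

/-- Definable submodules of a presented module. -/
def DefOn (A : Submodule R M) : Prop := Dfn P.c (P.pull A)

theorem DefOn.top : DefOn P ⊤ := by
  unfold DefOn
  convert P.hdom using 1
  ext x
  simp [Pres.mem_pull]

theorem DefOn.bot : DefOn P ⊥ := by
  unfold DefOn
  convert P.hker using 1
  ext x
  simp [Pres.mem_pull]

variable {P} in
theorem DefOn.inf {A B : Submodule R M} (hA : DefOn P A) (hB : DefOn P B) : DefOn P (A ⊓ B) := by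
  unfold DefOn
  convert Dfn.inf hA hB using 1
  ext x
  simp only [Pres.mem_pull, Submodule.mem_inf]
  constructor
  · rintro ⟨m, ⟨h1, h2⟩, h⟩
    exact ⟨⟨m, h1, h⟩, ⟨m, h2, h⟩⟩
  · rintro ⟨⟨m, h1, h⟩, ⟨m', h2, h'⟩⟩
    obtain rfl := Pres.sv2 h h'
    exact ⟨m, ⟨h1, h2⟩, h⟩

/-- Linear maps tracked by a basic map of contexts. -/
def Tracked (g : M →ₗ[R] N) : Prop :=
  ∃ s : P.W →ₗ[R] Q.W, Basic P.c Q.c s ∧ ∀ x m, (x, m) ∈ P.rel → (s x, g m) ∈ Q.rel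

variable {P Q S}

theorem Tracked.comapDef {g : M →ₗ[R] N} (hg : Tracked P Q g) {A : Submodule R N}
    (hA : DefOn Q A) : DefOn P (A.comap g) := by
  obtain ⟨s, hs, h⟩ := hg
  unfold DefOn
  convert Dfn.inf P.hdom (Dfn.comap hs hA) using 1
  ext x
  simp only [Pres.mem_pull, Submodule.mem_inf, Submodule.mem_comap, Submodule.mem_map,
    Prod.exists, LinearMap.fst_apply]
  constructor
  · rintro ⟨m, h1, h2⟩
    exact ⟨⟨x, m, h2, rfl⟩, ⟨_, h1, h _ _ h2⟩⟩
  · rintro ⟨⟨x', m, h2, rfl⟩, ⟨n, h1, h3⟩⟩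
    obtain rfl := Pres.sv2 (h _ _ h2) h3
    exact ⟨m, h1, h2⟩

theorem Tracked.mapDef {g : M →ₗ[R] N} (hg : Tracked P Q g) {A : Submodule R M}
    (hA : DefOn P A) : DefOn Q (A.map g) := by
  obtain ⟨s, hs, h⟩ := hg
  unfold DefOn
  convert Dfn.sup (Dfn.map hs hA) (DefOn.bot Q) using 1
  ext y
  simp only [Pres.mem_pull, Submodule.mem_sup, Submodule.mem_map, Submodule.mem_bot]
  constructor
  · rintro ⟨_, ⟨m, hm, rfl⟩, h1⟩
    obtain ⟨x, hx⟩ := P.surj m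
    refine ⟨s x, ⟨x, ⟨m, hm, hx⟩, rfl⟩, y - s x, ⟨0, rfl, ?_⟩, by abel⟩
    simpa using Q.rel.sub_mem h1 (h _ _ hx)
  · rintro ⟨_, ⟨x, ⟨m, hm, hx⟩, rfl⟩, z, ⟨_, rfl, hz⟩, rfl⟩
    exact ⟨g m, ⟨m, hm, rfl⟩, by simpa using Q.rel.add_mem (h _ _ hx) hz⟩

theorem Tracked.id : Tracked P P LinearMap.id := ⟨_, Basic.id _, fun _ _ h => h⟩

theorem Tracked.comp {g : M →ₗ[R] N} {h : N →ₗ[R] K} (hg : Tracked P Q g) (hh : Tracked Q S h) :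
    Tracked P S (h ∘ₗ g) := by
  obtain ⟨s, hs, h1⟩ := hg
  obtain ⟨t, ht, h2⟩ := hh
  exact ⟨_, hs.comp ht, fun x m h => h2 _ _ (h1 _ _ h)⟩

theorem Tracked.zero : Tracked P Q 0 := ⟨_, Basic.zero _ _, fun _ _ _ => Q.rel.zero_mem⟩

theorem Tracked.add {g h : M →ₗ[R] N} (hg : Tracked P Q g) (hh : Tracked P Q h) :
    Tracked P Q (g + h) := by
  obtain ⟨s, hs, h1⟩ := hg
  obtain ⟨t, ht, h2⟩ := hh
  exact ⟨_, hs.add ht, fun x m h => Q.rel.add_mem (h1 _ _ h) (h2 _ _ h)⟩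

theorem Tracked.smul (r : R) {g : M →ₗ[R] N} (hg : Tracked P Q g) :
    Tracked P Q (r • g) := by
  obtain ⟨s, hs, h1⟩ := hg
  exact ⟨_, hs.smul r, fun x m h => Q.rel.smul_mem r (h1 _ _ h)⟩

variable (P Q) in
/-- Product of presentations. -/
def Pres.prod : Pres T (M × N) where
  W := P.W × Q.W
  c := P.c.prod Q.c
  rel := P.rel.comap (LinearMap.prodMap (LinearMap.fst R _ _) (LinearMap.fst R _ _)) ⊓
    Q.rel.comap (LinearMap.prodMap (LinearMap.snd R _ _) (LinearMap.snd R _ _))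
  sv := by
    rintro ⟨m, n⟩ ⟨h1, h2⟩
    exact Prod.ext (P.sv m h1) (Q.sv n h2)
  surj := by
    rintro ⟨m, n⟩
    obtain ⟨x, hx⟩ := P.surj m
    obtain ⟨y, hy⟩ := Q.surj n
    exact ⟨(x, y), hx, hy⟩
  hdom := by
    convert Dfn.inf (Dfn.comap (Basic.fst P.c Q.c) P.hdom)
      (Dfn.comap (Basic.snd P.c Q.c) Q.hdom) using 1
    ext ⟨x, y⟩
    simp
  hker := by
    convert Dfn.inf (Dfn.comap (Basic.fst P.c Q.c) P.hker)
      (Dfn.comap (Basic.snd P.c Q.c) Q.hker) using 1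
    ext ⟨x, y⟩
    simp

theorem Pres.mem_prod_rel {x : P.W} {y : Q.W} {m : M} {n : N} :
    (((x, y), (m, n)) : (P.W × Q.W) × (M × N)) ∈ (P.prod Q).rel ↔
      (x, m) ∈ P.rel ∧ (y, n) ∈ Q.rel := Iff.rfl

theorem Tracked.fst : Tracked (P.prod Q) P (LinearMap.fst R M N) :=
  ⟨_, Basic.fst _ _, fun _ _ h => h.1⟩

theorem Tracked.snd : Tracked (P.prod Q) Q (LinearMap.snd R M N) :=
  ⟨_, Basic.snd _ _, fun _ _ h => h.2⟩

theorem Tracked.pair {g : M →ₗ[R] N} {h : M →ₗ[R] K} (hg : Tracked P Q g) (hh : Tracked P S h) :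
    Tracked P (Q.prod S) (g.prod h) := by
  obtain ⟨s, hs, h1⟩ := hg
  obtain ⟨t, ht, h2⟩ := hh
  exact ⟨_, hs.pair ht, fun x m h => ⟨h1 _ _ h, h2 _ _ h⟩⟩

variable (P Q) in
/-- Definable linear maps: those whose graph is definable. -/
def IsHom (g : M →ₗ[R] N) : Prop := DefOn (P.prod Q) g.graph

theorem Tracked.isHom {g : M →ₗ[R] N} (hg : Tracked P Q g) : IsHom P Q g := by
  unfold IsHom
  convert ((Tracked.fst (P := P) (Q := Q)).comp hg |>.add (Tracked.snd.smul (-1))).comapDef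
    (DefOn.bot Q) using 1
  ext ⟨m, n⟩
  simp only [LinearMap.mem_graph_iff, Submodule.mem_comap, Submodule.mem_bot, LinearMap.add_apply,
    LinearMap.comp_apply, LinearMap.fst_apply, LinearMap.snd_apply,
    neg_smul, one_smul, LinearMap.neg_apply]
  rw [← sub_eq_add_neg, sub_eq_zero, eq_comm]

theorem IsHom.comp {g : M →ₗ[R] N} {h : N →ₗ[R] K} (hg : IsHom P Q g) (hh : IsHom Q S h) :
    IsHom P S (h ∘ₗ g) := by
  have t1 : Tracked (P.prod (Q.prod S)) (P.prod Q) _ :=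
    Tracked.fst.pair (Tracked.snd.comp Tracked.fst)
  have t2 : Tracked (P.prod (Q.prod S)) (P.prod S) _ :=
    Tracked.fst.pair (Tracked.snd.comp Tracked.snd)
  have t3 : Tracked (P.prod (Q.prod S)) (Q.prod S) _ := Tracked.snd
  unfold IsHom
  convert t2.mapDef ((t1.comapDef hg).inf (t3.comapDef hh)) using 1
  ext ⟨m, k⟩
  simp only [LinearMap.mem_graph_iff, Submodule.mem_map, Submodule.mem_inf, Submodule.mem_comap,
    LinearMap.comp_apply]
  constructor
  · rintro rfl
    exact ⟨(m, g m, h (g m)), ⟨rfl, rfl⟩, rfl⟩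
  · rintro ⟨⟨m', n', k'⟩, ⟨h1, h2⟩, h3⟩
    simp at h1 h2 h3
    obtain ⟨rfl, rfl⟩ := h3
    rw [h2, h1]

theorem IsHom.pair {g : M →ₗ[R] N} {h : M →ₗ[R] K} (hg : IsHom P Q g) (hh : IsHom P S h) :
    IsHom P (Q.prod S) (g.prod h) := by
  have t1 : Tracked (P.prod (Q.prod S)) (P.prod Q) _ :=
    Tracked.fst.pair (Tracked.snd.comp Tracked.fst)
  have t2 : Tracked (P.prod (Q.prod S)) (P.prod S) _ :=
    Tracked.fst.pair (Tracked.snd.comp Tracked.snd)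
  unfold IsHom
  convert ((t1.comapDef hg).inf (t2.comapDef hh)) using 1
  ext ⟨m, n, k⟩
  simp [Prod.ext_iff]

theorem IsHom.add {g h : M →ₗ[R] N} (hg : IsHom P Q g) (hh : IsHom P Q h) :
    IsHom P Q (g + h) := by
  have t : Tracked (Q.prod Q) Q _ := Tracked.fst.add Tracked.snd
  have h1 := (hg.pair hh).comp t.isHom
  have e : (LinearMap.fst R N N + LinearMap.snd R N N) ∘ₗ (g.prod h) = g + h := by
    ext; simp
  rwa [e] at h1

theorem IsHom.smul (r : R) {g : M →ₗ[R] N} (hg : IsHom P Q g) : IsHom P Q (r • g) := by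
  have t : Tracked Q Q _ := Tracked.id.smul r
  have h1 := hg.comp t.isHom
  have e : (r • LinearMap.id) ∘ₗ g = r • g := by
    ext; simp
  rwa [e] at h1

theorem IsHom.comapDef {g : M →ₗ[R] N} (hg : IsHom P Q g) {A : Submodule R N}
    (hA : DefOn Q A) : DefOn P (A.comap g) := by
  convert Tracked.fst.mapDef (hg.inf (Tracked.snd.comapDef hA)) using 1
  ext m
  simp

theorem IsHom.mapDef {g : M →ₗ[R] N} (hg : IsHom P Q g) {A : Submodule R M}
    (hA : DefOn P A) : DefOn Q (A.map g) := by
  convert Tracked.snd.mapDef (hg.inf (Tracked.fst.comapDef hA)) using 1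
  ext m
  simp [and_comm, eq_comm]

theorem IsHom.lift {g : M →ₗ[R] N} (hg : IsHom P Q g) (inj : Function.Injective g)
    {h : K →ₗ[R] N} (hh : IsHom S Q h) {k : K →ₗ[R] M} (e : g ∘ₗ k = h) : IsHom S P k := by
  have t : IsHom (S.prod P) (S.prod Q) _ :=
    Tracked.fst.isHom.pair (Tracked.snd.isHom.comp hg)
  unfold IsHom
  convert t.comapDef hh using 1
  ext ⟨x, m⟩
  subst e
  simp [inj.eq_iff]

theorem IsHom.desc {g : M →ₗ[R] N} (hg : IsHom P Q g) (sur : Function.Surjective g)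
    {h : M →ₗ[R] K} (hh : IsHom P S h) {k : N →ₗ[R] K} (e : k ∘ₗ g = h) : IsHom Q S k := by
  have t : IsHom (P.prod S) (Q.prod S) _ :=
    (Tracked.fst.isHom.comp hg).pair Tracked.snd.isHom
  unfold IsHom
  convert t.mapDef hh using 1
  ext ⟨n, x⟩
  subst e
  obtain ⟨m, rfl⟩ := sur n
  simp only [LinearMap.mem_graph_iff, Submodule.mem_map]
  constructor
  · rintro rfl
    exact ⟨(m, k (g m)), rfl, rfl⟩
  · rintro ⟨⟨m', x'⟩, h1, h2⟩
    simp at h1 h2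
    rw [← h2.2, h1, h2.1]

/-- Presentation of a definable submodule. -/
def Pres.sub (P : Pres T M) (A : Submodule R M) (hA : DefOn P A) : Pres T A where
  W := P.W
  c := P.c
  rel := P.rel.comap (LinearMap.prodMap LinearMap.id A.subtype)
  sv m h := Subtype.ext (P.sv _ h)
  surj m := P.surj m
  hdom := by
    have hA' : Dfn P.c (P.pull A) := hA
    convert hA' using 1
    ext x
    simp [Pres.mem_pull]
  hker := by
    convert P.hker using 1
    ext x
    simp

theorem Pres.tracked_sub (P : Pres T M) (A : Submodule R M) (hA : DefOn P A) :
    Tracked (P.sub A hA) P A.subtype :=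
  ⟨_, Basic.id _, fun _ _ h => h⟩

/-- Presentation of a quotient by a definable submodule. -/
def Pres.quot (P : Pres T M) (A : Submodule R M) (hA : DefOn P A) : Pres T (M ⧸ A) where
  W := P.W
  c := P.c
  rel := P.rel.map (LinearMap.prodMap LinearMap.id A.mkQ)
  sv := by
    rintro _ ⟨⟨x, m⟩, h, e⟩
    simp at e
    obtain ⟨rfl, rfl⟩ := e
    rw [P.sv m h]; rfl
  surj n := by
    obtain ⟨m, rfl⟩ := A.mkQ_surjective n
    obtain ⟨x, hx⟩ := P.surj m
    exact ⟨x, _, hx, rfl⟩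
  hdom := by
    convert P.hdom using 1
    ext x
    simp
  hker := by
    have hA' : Dfn P.c (P.pull A) := hA
    convert hA' using 1
    ext x
    simp [Pres.mem_pull, and_comm]

theorem Pres.tracked_quot (P : Pres T M) (A : Submodule R M) (hA : DefOn P A) :
    Tracked P (P.quot A hA) A.mkQ :=
  ⟨_, Basic.id _, fun x m h => ⟨(x, m), h, rfl⟩⟩

/-- Presentation of a context by itself. -/
def Pres.ofCtx (c : Ctx T M) : Pres T M where
  W := M
  c := c
  rel := LinearMap.graph LinearMap.id
  sv := by simp
  surj := by simp
  hdom := by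
    convert Dfn.top c
    ext x
    simp
  hker := by
    convert Dfn.bot c
    ext x
    simp [eq_comm]

theorem Pres.tracked_ofCtx {c : Ctx T M} {d : Ctx T N} {s : M →ₗ[R] N} (hs : Basic c d s) :
    Tracked (Pres.ofCtx c) (Pres.ofCtx d) s :=
  ⟨s, hs, fun _ _ h => congrArg s h⟩

theorem Pres.defOn_rel (P : Pres T M) : DefOn ((Pres.ofCtx P.c).prod P) P.rel := by
  unfold DefOn
  have b1 : Basic (P.c.prod P.c) P.c _ := Basic.fst _ _
  have b2 : Basic (P.c.prod P.c) P.c _ := Basic.snd _ _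
  have h0 := Dfn.inf (Dfn.comap b1 P.hdom) (Dfn.comap (b1.add (b2.smul (-1))) P.hker)
  refine (congrArg (Dfn (P.c.prod P.c)) ?_).mpr h0
  apply Submodule.ext
  rintro ⟨x, y⟩
  constructor
  · intro h
    obtain ⟨⟨x', m⟩, h1, h2⟩ := (Pres.mem_pull _).1 h
    obtain ⟨h2, h3⟩ := h2
    have h2 : x' = x := h2
    subst h2
    have h3 : (y, m) ∈ P.rel := h3
    refine ⟨⟨_, h1, rfl⟩, ?_⟩
    show (x' + (-1 : R) • y, (0 : M)) ∈ P.rel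
    simpa [sub_eq_add_neg] using P.rel.sub_mem h1 h3
  · rintro ⟨⟨⟨x', m⟩, h1, rfl⟩, h2⟩
    refine (Pres.mem_pull _).2 ⟨(x', m), h1, ?_, ?_⟩
    · exact (rfl : x' = x')
    · have h2 : (x' + (-1 : R) • y, (0 : M)) ∈ P.rel := h2
      have h2 : (x' - y, (0 : M)) ∈ P.rel := by simpa [sub_eq_add_neg] using h2
      show (y, m) ∈ P.rel
      simpa using P.rel.sub_mem h1 h2

end

end Definable

section Cat

variable {R : Type u} [CommRing R] {D : Type v} [Quiver.{w} D] (T : D ⥤q ModuleCat.{u} R)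

/-- Objects of Nori's category. -/
structure Obj : Type (max (u + 1) v) where
  /-- the underlying module -/
  M : ModuleCat.{u} R
  /-- its presentation -/
  P : Pres T M

variable {T}

namespace Obj

/-- Morphisms of Nori's category. -/
@[ext]
structure Hom (X Y : Obj T) : Type (max u v) where
  /-- the underlying linear map -/
  g : X.M →ₗ[R] Y.M
  isHom : IsHom X.P Y.P g

instance : Category.{max u v} (Obj T) where
  Hom X Y := Hom X Y
  id X := ⟨LinearMap.id, Tracked.id.isHom⟩
  comp a b := ⟨b.g ∘ₗ a.g, a.isHom.comp b.isHom⟩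

/-- The linear map underlying a morphism. -/
def lin {X Y : Obj T} (a : X ⟶ Y) : X.M →ₗ[R] Y.M := Hom.g a

theorem lin_isHom {X Y : Obj T} (a : X ⟶ Y) : IsHom X.P Y.P (lin a) := Hom.isHom a

/-- Build a morphism. -/
def mk' {X Y : Obj T} (g : X.M →ₗ[R] Y.M) (h : IsHom X.P Y.P g) : X ⟶ Y := Hom.mk g h

@[simp] theorem lin_mk' {X Y : Obj T} (g : X.M →ₗ[R] Y.M) (h : IsHom X.P Y.P g) :
    lin (mk' g h) = g := rfl

theorem hom_ext {X Y : Obj T} {a b : X ⟶ Y} (h : lin a = lin b) : a = b := Hom.ext h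

theorem lin_injective {X Y : Obj T} : Function.Injective (lin (X := X) (Y := Y)) :=
  fun _ _ h => hom_ext h

@[simp] theorem lin_id (X : Obj T) : lin (𝟙 X) = LinearMap.id := rfl

@[simp] theorem lin_comp {X Y Z : Obj T} (a : X ⟶ Y) (b : Y ⟶ Z) :
    lin (a ≫ b) = lin b ∘ₗ lin a := rfl

instance {X Y : Obj T} : Zero (X ⟶ Y) := ⟨mk' 0 Tracked.zero.isHom⟩
instance {X Y : Obj T} : Add (X ⟶ Y) :=
  ⟨fun a b => mk' (lin a + lin b) ((lin_isHom a).add (lin_isHom b))⟩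
instance {X Y : Obj T} : SMul R (X ⟶ Y) :=
  ⟨fun r a => mk' (r • lin a) ((lin_isHom a).smul r)⟩
instance {X Y : Obj T} : Neg (X ⟶ Y) := ⟨fun a => (-1 : R) • a⟩
instance {X Y : Obj T} : Sub (X ⟶ Y) := ⟨fun a b => a + -b⟩
instance {X Y : Obj T} : SMul ℕ (X ⟶ Y) := ⟨fun n a => (n : R) • a⟩
instance {X Y : Obj T} : SMul ℤ (X ⟶ Y) := ⟨fun n a => (n : R) • a⟩

@[simp] theorem lin_zero {X Y : Obj T} : lin (0 : X ⟶ Y) = 0 := rfl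
@[simp] theorem lin_add {X Y : Obj T} (a b : X ⟶ Y) : lin (a + b) = lin a + lin b := rfl
@[simp] theorem lin_smul {X Y : Obj T} (r : R) (a : X ⟶ Y) : lin (r • a) = r • lin a := rfl
@[simp] theorem lin_neg {X Y : Obj T} (a : X ⟶ Y) : lin (-a) = - lin a := by
  show (-1 : R) • lin a = _
  simp
@[simp] theorem lin_sub {X Y : Obj T} (a b : X ⟶ Y) : lin (a - b) = lin a - lin b := by
  show lin (a + -b) = _
  simp [sub_eq_add_neg]
theorem lin_nsmul {X Y : Obj T} (a : X ⟶ Y) (n : ℕ) : lin (n • a) = n • lin a := by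
  show (n : R) • lin a = _
  exact Nat.cast_smul_eq_nsmul R n (lin a)
theorem lin_zsmul {X Y : Obj T} (a : X ⟶ Y) (n : ℤ) : lin (n • a) = n • lin a := by
  show (n : R) • lin a = _
  exact Int.cast_smul_eq_zsmul R n (lin a)

instance {X Y : Obj T} : AddCommGroup (X ⟶ Y) :=
  Function.Injective.addCommGroup lin lin_injective rfl lin_add lin_neg lin_sub
    lin_nsmul lin_zsmul

/-- `lin` as an additive map. -/
def linHom (X Y : Obj T) : (X ⟶ Y) →+ (X.M →ₗ[R] Y.M) where
  toFun := lin
  map_zero' := rfl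
  map_add' _ _ := rfl

instance {X Y : Obj T} : Module R (X ⟶ Y) :=
  Function.Injective.module R (linHom X Y) lin_injective lin_smul

instance : Preadditive (Obj T) where
  add_comp _ _ _ _ _ _ := hom_ext (by simp [LinearMap.comp_add])
  comp_add _ _ _ _ _ _ := hom_ext (by simp [LinearMap.add_comp])

instance : CategoryTheory.Linear R (Obj T) where
  smul_comp _ _ _ _ _ _ := hom_ext (by simp [LinearMap.comp_smul])
  comp_smul _ _ _ _ _ _ := hom_ext (by simp [LinearMap.smul_comp])

/-- Definable subobject. -/
def sub (X : Obj T) (A : Submodule R X.M) (hA : DefOn X.P A) : Obj T :=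
  ⟨ModuleCat.of R A, X.P.sub A hA⟩

/-- Inclusion of a definable subobject. -/
def incl (X : Obj T) (A : Submodule R X.M) (hA : DefOn X.P A) : X.sub A hA ⟶ X :=
  mk' A.subtype (X.P.tracked_sub A hA).isHom

/-- Definable quotient object. -/
def quot (X : Obj T) (A : Submodule R X.M) (hA : DefOn X.P A) : Obj T :=
  ⟨ModuleCat.of R (X.M ⧸ A), X.P.quot A hA⟩

/-- Projection on a definable quotient. -/
def proj (X : Obj T) (A : Submodule R X.M) (hA : DefOn X.P A) : X ⟶ X.quot A hA :=
  mk' A.mkQ (X.P.tracked_quot A hA).isHom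

theorem defOn_ker {X Y : Obj T} (a : X ⟶ Y) : DefOn X.P (LinearMap.ker (lin a)) :=
  (lin_isHom a).comapDef (DefOn.bot _)

theorem defOn_range {X Y : Obj T} (a : X ⟶ Y) : DefOn Y.P (LinearMap.range (lin a)) := by
  have := (lin_isHom a).mapDef (DefOn.top X.P)
  rwa [Submodule.map_top] at this

theorem exists_lift {X Y Z : Obj T} (a : X ⟶ Y) (ha : Function.Injective (lin a)) (b : Z ⟶ Y)
    (hb : ∀ z, ∃ x, lin a x = lin b z) : ∃ k : Z ⟶ X, k ≫ a = b := by
  let k : Z.M →ₗ[R] X.M := (LinearEquiv.ofInjective (lin a) ha).symm.toLinearMap ∘ₗ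
    (lin b).codRestrict (LinearMap.range (lin a)) hb
  have hk : lin a ∘ₗ k = lin b := by
    ext z
    have := (LinearEquiv.ofInjective (lin a) ha).apply_symm_apply
      ((lin b).codRestrict (LinearMap.range (lin a)) hb z)
    exact congrArg Subtype.val this
  exact ⟨mk' k ((lin_isHom a).lift ha (lin_isHom b) hk), hom_ext hk⟩

theorem exists_desc {X Y Z : Obj T} (a : X ⟶ Y) (ha : Function.Surjective (lin a)) (b : X ⟶ Z)
    (hb : ∀ x, lin a x = 0 → lin b x = 0) : ∃ k : Y ⟶ Z, a ≫ k = b := by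
  let k : Y.M →ₗ[R] Z.M := (LinearMap.ker (lin a)).liftQ (lin b) hb ∘ₗ
    ((lin a).quotKerEquivOfSurjective ha).symm.toLinearMap
  have hk : k ∘ₗ lin a = lin b := by
    ext x
    have : ((lin a).quotKerEquivOfSurjective ha).symm (lin a x) = Submodule.Quotient.mk x := by
      rw [LinearEquiv.symm_apply_eq]; rfl
    simp only [k, LinearMap.comp_apply, LinearEquiv.coe_coe, this]
    rfl
  exact ⟨mk' k ((lin_isHom a).desc ha (lin_isHom b) hk), hom_ext hk⟩

theorem mono_of_inj {X Y : Obj T} (a : X ⟶ Y) (ha : Function.Injective (lin a)) : Mono a where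
  right_cancellation b c h := by
    apply hom_ext
    ext z
    apply ha
    exact LinearMap.congr_fun (congrArg lin h) z

theorem epi_of_surj {X Y : Obj T} (a : X ⟶ Y) (ha : Function.Surjective (lin a)) : Epi a where
  left_cancellation b c h := by
    apply hom_ext
    ext z
    obtain ⟨x, rfl⟩ := ha z
    exact LinearMap.congr_fun (congrArg lin h) x

theorem inj_of_mono {X Y : Obj T} (a : X ⟶ Y) [Mono a] : Function.Injective (lin a) := by
  rw [← LinearMap.ker_eq_bot, eq_bot_iff]
  intro x hx
  have : X.incl _ (defOn_ker a) = 0 := by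
    rw [← cancel_mono a, zero_comp]
    apply hom_ext
    ext ⟨y, hy⟩
    exact hy
  exact LinearMap.congr_fun (congrArg lin this) ⟨x, hx⟩

theorem surj_of_epi {X Y : Obj T} (a : X ⟶ Y) [Epi a] : Function.Surjective (lin a) := by
  intro y
  have : Y.proj _ (defOn_range a) = 0 := by
    rw [← cancel_epi a, comp_zero]
    apply hom_ext
    ext x
    exact (Submodule.Quotient.mk_eq_zero _).2 ⟨x, rfl⟩
  exact (Submodule.Quotient.mk_eq_zero (LinearMap.range (lin a))).1
    (LinearMap.congr_fun (congrArg lin this) y)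

/-- Concrete kernels. -/
noncomputable def isLimitOfExact {X Y Z : Obj T} (a : X ⟶ Y) (b : Y ⟶ Z) (w : a ≫ b = 0)
    (ha : Function.Injective (lin a)) (h : ∀ y, lin b y = 0 → ∃ x, lin a x = y) :
    IsLimit (KernelFork.ofι a w) :=
  have := mono_of_inj a ha
  have key : ∀ {W : Obj T} (c : W ⟶ Y), c ≫ b = 0 → ∃ k : W ⟶ X, k ≫ a = c := fun c hc =>
    exists_lift a ha c fun z => h _ (LinearMap.congr_fun (congrArg lin hc) z)
  KernelFork.IsLimit.ofι a w (fun c hc => (key c hc).choose) (fun c hc => (key c hc).choose_spec)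
    (fun c hc m hm => by rw [← cancel_mono a, hm, (key c hc).choose_spec])

/-- Concrete cokernels. -/
noncomputable def isColimitOfExact {X Y Z : Obj T} (a : X ⟶ Y) (b : Y ⟶ Z) (w : a ≫ b = 0)
    (hb : Function.Surjective (lin b)) (h : ∀ y, lin b y = 0 → ∃ x, lin a x = y) :
    IsColimit (CokernelCofork.ofπ b w) :=
  have := epi_of_surj b hb
  have key : ∀ {W : Obj T} (c : Y ⟶ W), a ≫ c = 0 → ∃ k : Z ⟶ W, b ≫ k = c := fun c hc =>
    exists_desc b hb c fun z hz => by
      obtain ⟨x, rfl⟩ := h z hz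
      exact LinearMap.congr_fun (congrArg lin hc) x
  CokernelCofork.IsColimit.ofπ b w (fun c hc => (key c hc).choose)
    (fun c hc => (key c hc).choose_spec)
    (fun c hc m hm => by rw [← cancel_epi b, hm, (key c hc).choose_spec])

theorem incl_comp {X Y : Obj T} (a : X ⟶ Y) : X.incl _ (defOn_ker a) ≫ a = 0 := by
  apply hom_ext
  ext ⟨y, hy⟩
  exact hy

theorem comp_proj {X Y : Obj T} (a : X ⟶ Y) : a ≫ Y.proj _ (defOn_range a) = 0 := by
  apply hom_ext
  ext x
  exact (Submodule.Quotient.mk_eq_zero _).2 ⟨x, rfl⟩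

theorem of_proj_eq_zero {X Y : Obj T} (a : X ⟶ Y) (y : Y.M)
    (h : lin (Y.proj _ (defOn_range a)) y = 0) : ∃ x, lin a x = y :=
  (Submodule.Quotient.mk_eq_zero (LinearMap.range (lin a))).1 h

instance : HasKernels (Obj T) where
  has_limit {X _} a := ⟨⟨_, isLimitOfExact (X.incl _ (defOn_ker a)) a (incl_comp a)
    Subtype.val_injective (fun y hy => ⟨⟨y, hy⟩, rfl⟩)⟩⟩

instance : HasCokernels (Obj T) where
  has_colimit {_ Y} a := ⟨⟨_, isColimitOfExact a (Y.proj _ (defOn_range a)) (comp_proj a)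
    (Submodule.mkQ_surjective _) (of_proj_eq_zero a)⟩⟩

instance : IsNormalMonoCategory (Obj T) where
  normalMonoOfMono {_ Y} a _ := ⟨{
    Z := _
    g := Y.proj _ (defOn_range a)
    w := comp_proj a
    isLimit := isLimitOfExact a _ _ (inj_of_mono a) (of_proj_eq_zero a) }⟩

instance : IsNormalEpiCategory (Obj T) where
  normalEpiOfEpi {X _} a _ := ⟨{
    W := _
    g := X.incl _ (defOn_ker a)
    w := incl_comp a
    isColimit := isColimitOfExact _ a _ (surj_of_epi a) (fun y hy => ⟨⟨y, hy⟩, rfl⟩) }⟩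

/-- Objects attached to contexts. -/
def ofCtx {M : Type u} [AddCommGroup M] [Module R M] (c : Ctx T M) : Obj T :=
  ⟨ModuleCat.of R M, Pres.ofCtx c⟩

theorem isZero_zero : IsZero (ofCtx (T := T) Ctx.zero) := by
  rw [IsZero.iff_id_eq_zero]
  apply hom_ext
  ext x
  exact Subsingleton.elim (α := PUnit) _ _

instance : HasZeroObject (Obj T) := ⟨⟨_, isZero_zero⟩⟩

/-- Products. -/
def prod (X Y : Obj T) : Obj T := ⟨ModuleCat.of R (X.M × Y.M), X.P.prod Y.P⟩

/-- First projection. -/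
def fst (X Y : Obj T) : X.prod Y ⟶ X := mk' (LinearMap.fst R X.M Y.M) Tracked.fst.isHom
/-- Second projection. -/
def snd (X Y : Obj T) : X.prod Y ⟶ Y := mk' (LinearMap.snd R X.M Y.M) Tracked.snd.isHom
/-- First injection. -/
def inl (X Y : Obj T) : X ⟶ X.prod Y :=
  mk' (LinearMap.id.prod 0 : X.M →ₗ[R] X.M × Y.M) (Tracked.id.pair Tracked.zero).isHom
/-- Second injection. -/
def inr (X Y : Obj T) : Y ⟶ X.prod Y :=
  mk' (LinearMap.prod 0 LinearMap.id : Y.M →ₗ[R] X.M × Y.M)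
    (Tracked.zero.pair Tracked.id).isHom

instance : HasBinaryBiproducts (Obj T) where
  has_binary_biproduct X Y := hasBinaryBiproduct_of_total
    { pt := X.prod Y
      fst := fst X Y
      snd := snd X Y
      inl := inl X Y
      inr := inr X Y
      inl_fst := rfl
      inl_snd := rfl
      inr_fst := rfl
      inr_snd := rfl } (by
        apply hom_ext
        apply LinearMap.ext
        rintro ⟨x, y⟩
        exact Prod.ext (add_zero x) (zero_add y))

instance : HasFiniteProducts (Obj T) :=
  have : HasBinaryProducts (Obj T) := inferInstance
  have : HasTerminal (Obj T) := inferInstance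
  hasFiniteProducts_of_has_binary_and_terminal

instance : Abelian (Obj T) where

end Obj

variable (T) in
/-- The forgetful functor. -/
def ff : Obj T ⥤ ModuleCat.{u} R where
  obj X := X.M
  map a := ModuleCat.ofHom (Obj.lin a)

instance : (ff T).Additive where
instance : (ff T).Linear R where
instance : (ff T).Faithful where
  map_injective h := Obj.hom_ext (congrArg ModuleCat.Hom.hom h)

theorem ff_exact : PreservesFiniteLimits (ff T) ∧ PreservesFiniteColimits (ff T) := by
  rw [((Functor.exact_tfae (ff T)).out 3 0 :)]
  intro S hS
  have := hS.mono_f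
  have := hS.epi_g
  have h1 := Obj.inj_of_mono S.f
  have h2 := Obj.surj_of_epi S.g
  refine { exact := ?_, mono_f := ?_, epi_g := ?_ }
  · rw [ShortComplex.moduleCat_exact_iff]
    intro y hy
    obtain ⟨l, hl⟩ := hS.exact.lift' (Obj.incl _ _ (Obj.defOn_ker S.g)) (Obj.incl_comp S.g)
    exact ⟨Obj.lin l (⟨y, hy⟩ : LinearMap.ker (Obj.lin S.g)),
      LinearMap.congr_fun (congrArg Obj.lin hl) (⟨y, hy⟩ : LinearMap.ker (Obj.lin S.g))⟩
  · exact (ModuleCat.mono_iff_injective _).2 h1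
  · exact (ModuleCat.epi_iff_surjective _).2 h2

theorem ff_isFEL : IsFEL R (ff T) :=
  ⟨inferInstance, ff_exact.1, ff_exact.2, inferInstance, inferInstance⟩

variable (T) in
/-- The universal representation. -/
def Ttil : D ⥤q Obj T where
  obj p := ⟨T.obj p, Pres.ofCtx (Ctx.vertex p)⟩
  map {p q} m := Obj.mk' (X := ⟨T.obj p, Pres.ofCtx (Ctx.vertex p)⟩)
    (Y := ⟨T.obj q, Pres.ofCtx (Ctx.vertex q)⟩) (T.map m).hom
    (Pres.tracked_ofCtx (Basic.edge m)).isHom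

theorem Ttil_ff : Ttil T ⋙q (ff T).toPrefunctor = T := rfl

end Cat

section Action

variable {R : Type u} [CommRing R] {D : Type v} [Quiver.{w} D] {T : D ⥤q ModuleCat.{u} R}

/-- Extension of an endomorphism of `T` to contexts. -/
def act (α : ∀ p : D, T.obj p →ₗ[R] T.obj p) :
    ∀ {M : Type u} [AddCommGroup M] [Module R M], Ctx T M → M →ₗ[R] M
  | _, _, _, Ctx.zero => LinearMap.id
  | _, _, _, Ctx.vertex p => α p
  | _, _, _, Ctx.prod c d => LinearMap.prodMap (act α c) (act α d)

theorem act_basic (α : ∀ p : D, T.obj p →ₗ[R] T.obj p)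
    (hα : ∀ ⦃p q : D⦄ (m : p ⟶ q) (x : T.obj p), (T.map m).hom (α p x) = α q ((T.map m).hom x))
    {M N : Type u} [AddCommGroup M] [Module R M] [AddCommGroup N] [Module R N]
    {c : Ctx T M} {d : Ctx T N} {s : M →ₗ[R] N} (hs : Basic c d s) :
    ∀ x, s (act α c x) = act α d (s x) := by
  induction hs with
  | id c => intro x; rfl
  | comp _ _ h1 h2 => intro x; simp [h1, h2]
  | fst c d => intro x; rfl
  | snd c d => intro x; rfl
  | pair _ _ h1 h2 => intro x; simp [act, h1, h2]
  | zero c d => intro x; simp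
  | add _ _ h1 h2 => intro x; simp [h1, h2]
  | smul r _ h1 => intro x; simp [h1]
  | edge m => intro x; exact hα m x

theorem act_dfn (α : ∀ p : D, T.obj p →ₗ[R] T.obj p)
    (hα : ∀ ⦃p q : D⦄ (m : p ⟶ q) (x : T.obj p), (T.map m).hom (α p x) = α q ((T.map m).hom x))
    {M : Type u} [AddCommGroup M] [Module R M]
    {c : Ctx T M} {A : Submodule R M} (hA : Dfn c A) :
    ∀ x ∈ A, act α c x ∈ A := by
  induction hA with
  | top c => intro x _; trivial
  | bot c => intro x hx; rw [Submodule.mem_bot] at hx ⊢; rw [hx, map_zero]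
  | inf _ _ h1 h2 => intro x hx; exact ⟨h1 _ hx.1, h2 _ hx.2⟩
  | map hs _ h =>
    rintro _ ⟨x, hx, rfl⟩
    exact ⟨_, h x hx, act_basic α hα hs x⟩
  | comap hs _ h =>
    intro x hx
    rw [Submodule.mem_comap, act_basic α hα hs]
    exact h _ hx

theorem act_act (α β : ∀ p : D, T.obj p →ₗ[R] T.obj p) (h : ∀ p x, β p (α p x) = x)
    {M : Type u} [AddCommGroup M] [Module R M] (c : Ctx T M) :
    ∀ x, act β c (act α c x) = x := by
  induction c with
  | zero => intro x; rfl
  | vertex p => exact h p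
  | prod c d h1 h2 => rintro ⟨x, y⟩; exact Prod.ext (h1 x) (h2 y)

theorem exists_actOn (α : ∀ p : D, T.obj p →ₗ[R] T.obj p)
    (hα : ∀ ⦃p q : D⦄ (m : p ⟶ q) (x : T.obj p), (T.map m).hom (α p x) = α q ((T.map m).hom x))
    {M : Type u} [AddCommGroup M] [Module R M] (P : Pres T M) :
    ∃ E : M →ₗ[R] M, ∀ x m, (x, m) ∈ P.rel → (act α P.c x, E m) ∈ P.rel := by
  have h0 : ∀ m, ∃ m' x, (x, m) ∈ P.rel ∧ (act α P.c x, m') ∈ P.rel := by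
    intro m
    obtain ⟨x, hx⟩ := P.surj m
    obtain ⟨⟨y, m'⟩, h1, h2⟩ := act_dfn α hα P.hdom x ⟨_, hx, rfl⟩
    have h2 : y = act α P.c x := h2
    subst h2
    exact ⟨m', x, hx, h1⟩
  choose E X h1 h2 using h0
  have key : ∀ x m, (x, m) ∈ P.rel → (act α P.c x, E m) ∈ P.rel := by
    intro x m hx
    have h3 : (x - X m, (0 : M)) ∈ P.rel := by simpa using P.rel.sub_mem hx (h1 m)
    have h4 : (act α P.c (x - X m), (0 : M)) ∈ P.rel := act_dfn α hα P.hker _ h3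
    simpa using P.rel.add_mem h4 (h2 m)
  refine ⟨{ toFun := E, map_add' := ?_, map_smul' := ?_ }, key⟩
  · intro m n
    refine Pres.sv2 (key _ _ (P.rel.add_mem (h1 m) (h1 n))) ?_
    simpa using P.rel.add_mem (h2 m) (h2 n)
  · intro r m
    refine Pres.sv2 (key _ _ (P.rel.smul_mem r (h1 m))) ?_
    simpa using P.rel.smul_mem r (h2 m)

theorem exists_actEquiv (α β : ∀ p : D, T.obj p →ₗ[R] T.obj p)
    (hα : ∀ ⦃p q : D⦄ (m : p ⟶ q) (x : T.obj p), (T.map m).hom (α p x) = α q ((T.map m).hom x))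
    (hβ : ∀ ⦃p q : D⦄ (m : p ⟶ q) (x : T.obj p), (T.map m).hom (β p x) = β q ((T.map m).hom x))
    (h1 : ∀ p x, β p (α p x) = x) (h2 : ∀ p x, α p (β p x) = x)
    {M : Type u} [AddCommGroup M] [Module R M] (P : Pres T M) :
    ∃ E : M ≃ₗ[R] M, ∀ x m, (x, m) ∈ P.rel → (act α P.c x, E m) ∈ P.rel := by
  obtain ⟨E, hE⟩ := exists_actOn α hα P
  obtain ⟨E', hE'⟩ := exists_actOn β hβ P
  refine ⟨LinearEquiv.ofLinearMap E E' ?_ ?_, hE⟩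
  · ext m
    obtain ⟨x, hx⟩ := P.surj m
    have h := hE _ _ (hE' _ _ hx)
    rw [act_act _ _ h2] at h
    exact Pres.sv2 h hx
  · ext m
    obtain ⟨x, hx⟩ := P.surj m
    have h := hE' _ _ (hE _ _ hx)
    rw [act_act _ _ h1] at h
    exact Pres.sv2 h hx

theorem act_natural (α : ∀ p : D, T.obj p →ₗ[R] T.obj p)
    (hα : ∀ ⦃p q : D⦄ (m : p ⟶ q) (x : T.obj p), (T.map m).hom (α p x) = α q ((T.map m).hom x))
    {M N : Type u} [AddCommGroup M] [Module R M] [AddCommGroup N] [Module R N]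
    {P : Pres T M} {Q : Pres T N} (E : M →ₗ[R] M) (E' : N →ₗ[R] N)
    (hE : ∀ x m, (x, m) ∈ P.rel → (act α P.c x, E m) ∈ P.rel)
    (hE' : ∀ x m, (x, m) ∈ Q.rel → (act α Q.c x, E' m) ∈ Q.rel)
    (g : M →ₗ[R] N) (hg : IsHom P Q g) (m : M) : g (E m) = E' (g m) := by
  obtain ⟨x, hx⟩ := P.surj m
  obtain ⟨y, hy⟩ := Q.surj (g m)
  have h1 : ((x, y) : P.W × Q.W) ∈ (P.prod Q).pull g.graph :=
    (Pres.mem_pull _).2 ⟨(m, g m), rfl, hx, hy⟩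
  have h2 := act_dfn α hα hg _ h1
  obtain ⟨⟨m', n'⟩, h3, h4⟩ := (Pres.mem_pull _).1 h2
  have h3 : n' = g m' := h3
  have h5 : (act α P.c x, m') ∈ P.rel := h4.1
  have h6 : (act α Q.c y, n') ∈ Q.rel := h4.2
  rw [Pres.sv2 (hE _ _ hx) h5, ← h3, Pres.sv2 (hE' _ _ hy) h6]

end Action

section Lifting

set_option linter.unusedSectionVars false

open ZeroObject

variable {R : Type u} [CommRing R] {D : Type v} [Quiver.{w} D]
  {A : Type a2} [Category.{b2} A] [Abelian A] [CategoryTheory.Linear R A]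
  (f : A ⥤ ModuleCat.{u} R)

/-- The linear map underlying the image of a morphism under `f`. -/
def fl {X Y : A} (g : X ⟶ Y) : f.obj X →ₗ[R] f.obj Y := (f.map g).hom

theorem fl_id {X : A} (x : f.obj X) : fl f (𝟙 X) x = x := by simp [fl]

theorem fl_comp {X Y Z : A} (g : X ⟶ Y) (h : Y ⟶ Z) (x : f.obj X) :
    fl f (g ≫ h) x = fl f h (fl f g x) := by simp [fl]

theorem fl_ext [f.Faithful] {X Y : A} {g h : X ⟶ Y} (e : ∀ x, fl f g x = fl f h x) : g = h :=
  f.map_injective (ModuleCat.hom_ext (LinearMap.ext e))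

variable [f.Additive]

theorem fl_zero {X Y : A} (x : f.obj X) : fl f (0 : X ⟶ Y) x = 0 := by simp [fl]

theorem fl_add {X Y : A} (g h : X ⟶ Y) (x : f.obj X) :
    fl f (g + h) x = fl f g x + fl f h x := by simp [fl, f.map_add]

theorem fl_sub {X Y : A} (g h : X ⟶ Y) (x : f.obj X) :
    fl f (g - h) x = fl f g x - fl f h x := by simp [fl, f.map_sub]

theorem fl_smul [f.Linear R] {X Y : A} (r : R) (g : X ⟶ Y) (x : f.obj X) :
    fl f (r • g) x = r • fl f g x := by simp [fl]

theorem biprod_ext {X Y : A} {z z' : f.obj (X ⊞ Y)}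
    (h1 : fl f biprod.fst z = fl f biprod.fst z')
    (h2 : fl f biprod.snd z = fl f biprod.snd z') : z = z' := by
  rw [← fl_id f z, ← fl_id f z', ← biprod.total, fl_add, fl_add, fl_comp, fl_comp, fl_comp,
    fl_comp, h1, h2]

theorem biprod_exists {X Y : A} (x : f.obj X) (y : f.obj Y) :
    ∃ z : f.obj (X ⊞ Y), fl f biprod.fst z = x ∧ fl f biprod.snd z = y := by
  refine ⟨fl f biprod.inl x + fl f biprod.inr y, ?_, ?_⟩
  · rw [map_add, ← fl_comp, ← fl_comp]
    simp [fl_id, fl_zero]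
  · rw [map_add, ← fl_comp, ← fl_comp]
    simp [fl_id, fl_zero]

variable [PreservesFiniteLimits f] [PreservesFiniteColimits f]

theorem exists_ker {X Y : A} (g : X ⟶ Y) (x : f.obj X) (hx : fl f g x = 0) :
    ∃ z, fl f (kernel.ι g) z = x := by
  have H : (PreservesFiniteLimits f ∧ PreservesFiniteColimits f) ↔
      ∀ S : ShortComplex A, S.Exact → (S.map f).Exact := (Functor.exact_tfae f).out 3 1
  have h := H.1 ⟨inferInstance, inferInstance⟩ _ (ShortComplex.exact_kernel g)
  rw [ShortComplex.moduleCat_exact_iff] at h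
  exact h x hx

theorem exists_pullback {X Y Z : A} (a : X ⟶ Z) (b : Y ⟶ Z) :
    ∃ (P : A) (p : P ⟶ X) (q : P ⟶ Y), p ≫ a = q ≫ b ∧
      ∀ x y, fl f a x = fl f b y → ∃ z, fl f p z = x ∧ fl f q z = y := by
  refine ⟨kernel ((biprod.fst : X ⊞ Y ⟶ X) ≫ a - biprod.snd ≫ b),
    kernel.ι _ ≫ biprod.fst, kernel.ι _ ≫ biprod.snd, ?_, ?_⟩
  · have := kernel.condition ((biprod.fst : X ⊞ Y ⟶ X) ≫ a - biprod.snd ≫ b)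
    rw [Preadditive.comp_sub, sub_eq_zero] at this
    simpa using this
  · intro x y h
    obtain ⟨w, hx, hy⟩ := biprod_exists f x y
    obtain ⟨z, hz⟩ := exists_ker f ((biprod.fst : X ⊞ Y ⟶ X) ≫ a - biprod.snd ≫ b) w (by
      rw [fl_sub, fl_comp, fl_comp, hx, hy, h, sub_self])
    exact ⟨z, by rw [fl_comp, hz, hx], by rw [fl_comp, hz, hy]⟩

theorem fl_surj_of_epi {X Y : A} (g : X ⟶ Y) [Epi g] : Function.Surjective (fl f g) :=
  (ModuleCat.epi_iff_surjective (f.map g)).1 inferInstance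

theorem fl_inj_of_mono {X Y : A} (g : X ⟶ Y) [Mono g] : Function.Injective (fl f g) :=
  (ModuleCat.mono_iff_injective (f.map g)).1 inferInstance

theorem epi_of_fl_surj [f.Faithful] {X Y : A} (g : X ⟶ Y) (h : Function.Surjective (fl f g)) :
    Epi g := by
  have : Epi (f.map g) := (ModuleCat.epi_iff_surjective (f.map g)).2 h
  exact f.epi_of_epi_map this

theorem fl_desc [f.Faithful] {X Y Z : A} (a : X ⟶ Y) (b : X ⟶ Z)
    (ha : Function.Surjective (fl f a)) (h : ∀ x, fl f a x = 0 → fl f b x = 0) :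
    ∃ φ : Y ⟶ Z, a ≫ φ = b := by
  have := epi_of_fl_surj f a ha
  refine ⟨Abelian.epiDesc a b ?_, Abelian.comp_epiDesc _ _ _⟩
  apply fl_ext f
  intro x
  rw [fl_zero, fl_comp]
  apply h
  rw [← fl_comp, kernel.condition, fl_zero]

theorem cokernel_eq_zero {X Y : A} (g : X ⟶ Y) (y : f.obj Y) (hy : fl f (cokernel.π g) y = 0) :
    ∃ x, fl f g x = y := by
  have H : (PreservesFiniteLimits f ∧ PreservesFiniteColimits f) ↔
      ∀ S : ShortComplex A, S.Exact → (S.map f).Exact := (Functor.exact_tfae f).out 3 1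
  have h := H.1 ⟨inferInstance, inferInstance⟩ _ (ShortComplex.exact_cokernel g)
  rw [ShortComplex.moduleCat_exact_iff] at h
  exact h y hy

variable (F : D ⥤q A)

/-- Realization of contexts in `A`. -/
noncomputable def evA : ∀ {M : Type u} [AddCommGroup M] [Module R M],
    Ctx (F ⋙q f.toPrefunctor) M → A
  | _, _, _, Ctx.zero => 0
  | _, _, _, Ctx.vertex p => F.obj p
  | _, _, _, Ctx.prod c d => evA c ⊞ evA d

/-- Comparison of the realizations. -/
noncomputable def tau : ∀ {M : Type u} [AddCommGroup M] [Module R M]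
    (c : Ctx (F ⋙q f.toPrefunctor) M), f.obj (evA f F c) →ₗ[R] M
  | _, _, _, Ctx.zero => 0
  | _, _, _, Ctx.vertex p => (LinearMap.id : f.obj (F.obj p) →ₗ[R] f.obj (F.obj p))
  | _, _, _, Ctx.prod c d =>
    LinearMap.prod (tau c ∘ₗ fl f (biprod.fst : evA f F c ⊞ evA f F d ⟶ _))
      (tau d ∘ₗ fl f (biprod.snd : evA f F c ⊞ evA f F d ⟶ _))

variable {M : Type u} [AddCommGroup M] [Module R M]

theorem tau_bij (c : Ctx (F ⋙q f.toPrefunctor) M) : Function.Bijective (tau f F c) := by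
  induction c with
  | zero =>
    refine ⟨fun x y _ => ?_, fun x => ⟨0, rfl⟩⟩
    have h : 𝟙 (0 : A) = 0 := (isZero_zero A).eq_of_src _ _
    have : ∀ z : f.obj (0 : A), z = 0 := fun z => by rw [← fl_id f z, h, fl_zero]
    exact (this x).trans (this y).symm
  | vertex p => exact Function.bijective_id
  | prod c d h1 h2 =>
    constructor
    · intro x y h
      exact biprod_ext f (h1.1 (congrArg Prod.fst h)) (h2.1 (congrArg Prod.snd h))
    · rintro ⟨x, y⟩
      obtain ⟨x, rfl⟩ := h1.2 x
      obtain ⟨y, rfl⟩ := h2.2 y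
      obtain ⟨z, rfl, rfl⟩ := biprod_exists f x y
      exact ⟨z, rfl⟩

theorem lift_basic [f.Linear R] {N : Type u} [AddCommGroup N] [Module R N]
    {c : Ctx (F ⋙q f.toPrefunctor) M} {d : Ctx (F ⋙q f.toPrefunctor) N} {s : M →ₗ[R] N}
    (hs : Basic c d s) :
    ∃ Φ : evA f F c ⟶ evA f F d, ∀ x, tau f F d (fl f Φ x) = s (tau f F c x) := by
  induction hs with
  | id c => exact ⟨𝟙 _, fun x => by rw [fl_id]; rfl⟩
  | comp _ _ h1 h2 =>
    obtain ⟨Φ, h1⟩ := h1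
    obtain ⟨Ψ, h2⟩ := h2
    exact ⟨Φ ≫ Ψ, fun x => by rw [fl_comp, h2, h1]; rfl⟩
  | fst c d => exact ⟨(biprod.fst : evA f F c ⊞ evA f F d ⟶ _), fun x => rfl⟩
  | snd c d => exact ⟨(biprod.snd : evA f F c ⊞ evA f F d ⟶ _), fun x => rfl⟩
  | pair _ _ h1 h2 =>
    obtain ⟨Φ, h1⟩ := h1
    obtain ⟨Ψ, h2⟩ := h2
    refine ⟨biprod.lift Φ Ψ, fun x => Prod.ext ?_ ?_⟩
    · refine Eq.trans ?_ (h1 x)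
      refine congrArg (tau f F _) ?_
      exact (fl_comp f (biprod.lift Φ Ψ) biprod.fst x).symm.trans (by rw [biprod.lift_fst])
    · refine Eq.trans ?_ (h2 x)
      refine congrArg (tau f F _) ?_
      exact (fl_comp f (biprod.lift Φ Ψ) biprod.snd x).symm.trans (by rw [biprod.lift_snd])
  | zero c d => exact ⟨0, fun x => by rw [fl_zero, map_zero]; rfl⟩
  | add _ _ h1 h2 =>
    obtain ⟨Φ, h1⟩ := h1
    obtain ⟨Ψ, h2⟩ := h2
    exact ⟨Φ + Ψ, fun x => by rw [fl_add, map_add, h2, h1]; rfl⟩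
  | smul r _ h1 =>
    obtain ⟨Φ, h1⟩ := h1
    exact ⟨r • Φ, fun x => by rw [fl_smul, map_smul, h1]; rfl⟩
  | edge m => exact ⟨F.map m, fun x => rfl⟩

theorem lift_dfn [f.Linear R] {c : Ctx (F ⋙q f.toPrefunctor) M} {N : Submodule R M}
    (hN : Dfn c N) :
    ∃ (Y : A) (g : Y ⟶ evA f F c), ∀ x, x ∈ N ↔ ∃ y, tau f F c (fl f g y) = x := by
  induction hN with
  | top c =>
    refine ⟨_, 𝟙 _, fun x => ⟨fun _ => ?_, fun _ => trivial⟩⟩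
    obtain ⟨y, hy⟩ := (tau_bij f F c).2 x
    exact ⟨y, by rw [fl_id, hy]⟩
  | bot c =>
    refine ⟨_, 0, fun x => ⟨fun hx => ⟨(0 : f.obj (evA f F c)), ?_⟩, ?_⟩⟩
    · rw [map_zero, map_zero]; exact hx.symm
    · rintro ⟨y, rfl⟩
      rw [fl_zero, map_zero]; exact Submodule.zero_mem _
  | @inf _ _ _ c _ _ _ _ h1 h2 =>
    obtain ⟨Y, g, hg⟩ := h1
    obtain ⟨Y', g', hg'⟩ := h2
    obtain ⟨P, p, q, hpq, H⟩ := exists_pullback f g g'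
    refine ⟨P, p ≫ g, fun x => ?_⟩
    rw [Submodule.mem_inf, hg, hg']
    constructor
    · rintro ⟨⟨y, rfl⟩, ⟨y', h⟩⟩
      obtain ⟨z, rfl, rfl⟩ := H y y' ((tau_bij f F c).1 h.symm)
      exact ⟨z, by rw [fl_comp]⟩
    · rintro ⟨z, rfl⟩
      exact ⟨⟨fl f p z, by rw [fl_comp]⟩, ⟨fl f q z, by rw [← fl_comp, hpq]⟩⟩
  | map hs _ h =>
    obtain ⟨Y, g, hg⟩ := h
    obtain ⟨Φ, hΦ⟩ := lift_basic f F hs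
    refine ⟨Y, g ≫ Φ, fun x => ?_⟩
    constructor
    · rintro ⟨y, hy, rfl⟩
      obtain ⟨z, rfl⟩ := (hg y).1 hy
      exact ⟨z, by rw [fl_comp, hΦ]⟩
    · rintro ⟨z, rfl⟩
      exact ⟨_, (hg _).2 ⟨z, rfl⟩, by rw [fl_comp, hΦ]⟩
  | @comap _ _ _ _ _ _ c d _ _ hs _ h =>
    obtain ⟨Y, g, hg⟩ := h
    obtain ⟨Φ, hΦ⟩ := lift_basic f F hs
    obtain ⟨P, p, q, hpq, H⟩ := exists_pullback f Φ g
    refine ⟨P, p, fun x => ?_⟩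
    rw [Submodule.mem_comap, hg]
    constructor
    · rintro ⟨y, hy⟩
      obtain ⟨x, rfl⟩ := (tau_bij f F c).2 x
      rw [← hΦ] at hy
      obtain ⟨z, rfl, rfl⟩ := H x y ((tau_bij f F d).1 hy.symm)
      exact ⟨z, rfl⟩
    · rintro ⟨z, rfl⟩
      exact ⟨fl f q z, by rw [← hΦ, ← fl_comp, ← fl_comp, hpq]⟩

end Lifting

section Lifts

set_option linter.unusedSectionVars false

variable {R : Type u} [CommRing R] {D : Type v} [Quiver.{w} D]
  {A : Type a2} [Category.{b2} A] [Abelian A] [CategoryTheory.Linear R A]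
  (f : A ⥤ ModuleCat.{u} R) [f.Additive] [f.Linear R]
  [PreservesFiniteLimits f] [PreservesFiniteColimits f] [f.Faithful] (F : D ⥤q A)

section

variable {M N : Type u} [AddCommGroup M] [Module R M] [AddCommGroup N] [Module R N]

/-- `Y` is a lift to `A` of the presented module `M`. -/
def IsLift (P : Pres (F ⋙q f.toPrefunctor) M) (Y : A) (θ : f.obj Y ≃ₗ[R] M) : Prop :=
  ∃ (U : A) (g : U ⟶ evA f F P.c) (e : U ⟶ Y),
    ∀ x m, (x, m) ∈ P.rel ↔ ∃ u, tau f F P.c (fl f g u) = x ∧ θ (fl f e u) = m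

theorem exists_isLift (P : Pres (F ⋙q f.toPrefunctor) M) :
    ∃ (Y : A) (θ : f.obj Y ≃ₗ[R] M), IsLift f F P Y θ := by
  obtain ⟨U, gU, hU⟩ := lift_dfn f F P.hdom
  obtain ⟨K, gK, hK⟩ := lift_dfn f F P.hker
  let h := gU ≫ cokernel.π gK
  have he : Function.Surjective (fl f (factorThruImage h)) := fl_surj_of_epi f _
  have hι : Function.Injective (fl f (image.ι h)) := fl_inj_of_mono f _
  have hm : ∀ u, ∃ m, (tau f F P.c (fl f gU u), m) ∈ P.rel := by
    intro u
    obtain ⟨⟨x, m⟩, h1, h2⟩ := (hU _).2 ⟨u, rfl⟩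
    have h2 : x = tau f F P.c (fl f gU u) := h2
    exact ⟨m, h2 ▸ h1⟩
  choose q hq using hm
  let ql : f.obj U →ₗ[R] M :=
    { toFun := q
      map_add' := fun u u' => Pres.sv2 (hq _) (by
        rw [map_add, map_add]; exact P.rel.add_mem (hq u) (hq u'))
      map_smul' := fun r u => Pres.sv2 (hq _) (by
        rw [map_smul, map_smul]; exact P.rel.smul_mem r (hq u)) }
  have hql : Function.Surjective ql := by
    intro m
    obtain ⟨x, hx⟩ := P.surj m
    obtain ⟨u, rfl⟩ := (hU x).1 ⟨_, hx, rfl⟩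
    exact ⟨u, Pres.sv2 (hq u) hx⟩
  have hker : LinearMap.ker (fl f (factorThruImage h)) = LinearMap.ker ql := by
    ext u
    rw [LinearMap.mem_ker, LinearMap.mem_ker]
    have h1 : fl f (factorThruImage h) u = 0 ↔ fl f (cokernel.π gK) (fl f gU u) = 0 := by
      rw [← fl_comp]
      show _ ↔ fl f h u = 0
      conv_rhs => rw [← image.fac h, fl_comp]
      exact (map_eq_zero_iff _ hι).symm
    rw [h1]
    constructor
    · intro h2
      obtain ⟨k, hk⟩ := cokernel_eq_zero f gK _ h2
      have h3 : (tau f F P.c (fl f gU u), (0 : M)) ∈ P.rel := (hK _).2 ⟨k, congrArg (tau f F P.c) hk⟩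
      exact Pres.sv2 (hq u) h3
    · intro h2
      have h2 : q u = 0 := h2
      have h3 := hq u
      rw [h2] at h3
      obtain ⟨k, hk⟩ := (hK _).1 h3
      rw [← (tau_bij f F P.c).1 hk, ← fl_comp, cokernel.condition, fl_zero]
  let θ : f.obj (image h) ≃ₗ[R] M :=
    ((fl f (factorThruImage h)).quotKerEquivOfSurjective he).symm ≪≫ₗ
      Submodule.quotEquivOfEq _ _ hker ≪≫ₗ ql.quotKerEquivOfSurjective hql
  have hθ : ∀ u, θ (fl f (factorThruImage h) u) = q u := by
    intro u
    have : ((fl f (factorThruImage h)).quotKerEquivOfSurjective he).symm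
        (fl f (factorThruImage h) u) = Submodule.Quotient.mk u := by
      rw [LinearEquiv.symm_apply_eq]; rfl
    simp only [θ, LinearEquiv.trans_apply, this]
    rfl
  refine ⟨image h, θ, U, gU, factorThruImage h, fun x m => ⟨fun hx => ?_, ?_⟩⟩
  · obtain ⟨u, rfl⟩ := (hU x).1 ⟨_, hx, rfl⟩
    exact ⟨u, rfl, (hθ u).trans (Pres.sv2 (hq u) hx)⟩
  · rintro ⟨u, rfl, rfl⟩
    rw [hθ]
    exact hq u

variable {f F}

theorem lift_hom {P : Pres (F ⋙q f.toPrefunctor) M} {Q : Pres (F ⋙q f.toPrefunctor) N}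
    {Y Y' : A} {θ : f.obj Y ≃ₗ[R] M} {θ' : f.obj Y' ≃ₗ[R] N}
    (hY : IsLift f F P Y θ) (hY' : IsLift f F Q Y' θ') {g : M →ₗ[R] N} (hg : IsHom P Q g) :
    ∃ φ : Y ⟶ Y', ∀ y, θ' (fl f φ y) = g (θ y) := by
  obtain ⟨U, gU, e, hU⟩ := hY
  obtain ⟨U', gU', e', hU'⟩ := hY'
  obtain ⟨P0, γ, hγ⟩ := lift_dfn f F hg
  let π₁ : evA f F (P.prod Q).c ⟶ evA f F P.c := (biprod.fst : evA f F P.c ⊞ evA f F Q.c ⟶ _)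
  let π₂ : evA f F (P.prod Q).c ⟶ evA f F Q.c := (biprod.snd : evA f F P.c ⊞ evA f F Q.c ⟶ _)
  have hτ : ∀ z, tau f F (P.prod Q).c z = (tau f F P.c (fl f π₁ z), tau f F Q.c (fl f π₂ z)) :=
    fun z => rfl
  obtain ⟨P1, p1, q1, c1, H1⟩ := exists_pullback f (γ ≫ π₁) gU
  obtain ⟨P2, p2, q2, c2, H2⟩ := exists_pullback f (p1 ≫ γ ≫ π₂) gU'
  have key : ∀ z, θ' (fl f (q2 ≫ e') z) = g (θ (fl f (p2 ≫ q1 ≫ e) z)) := by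
    intro z
    have h1 := (hγ _).2 ⟨fl f (p2 ≫ p1) z, rfl⟩
    obtain ⟨⟨m, n⟩, h2, h3⟩ := (Pres.mem_pull _).1 h1
    have h2 : n = g m := h2
    subst h2
    rw [hτ] at h3
    obtain ⟨h4, h5⟩ := Pres.mem_prod_rel.1 h3
    have h6 : (tau f F P.c (fl f π₁ (fl f γ (fl f (p2 ≫ p1) z))),
        θ (fl f (p2 ≫ q1 ≫ e) z)) ∈ P.rel := by
      refine (hU _ _).2 ⟨fl f (p2 ≫ q1) z, ?_, ?_⟩
      · rw [← fl_comp, ← fl_comp, ← fl_comp, Category.assoc, Category.assoc, ← c1]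
      · rw [← fl_comp, Category.assoc]
    have h7 : (tau f F Q.c (fl f π₂ (fl f γ (fl f (p2 ≫ p1) z))),
        θ' (fl f (q2 ≫ e') z)) ∈ Q.rel := by
      refine (hU' _ _).2 ⟨fl f q2 z, ?_, ?_⟩
      · rw [← fl_comp, ← fl_comp, ← fl_comp, Category.assoc, ← c2]
      · rw [← fl_comp]
    rw [Pres.sv2 h6 h4, Pres.sv2 h7 h5]
  have hsurj : Function.Surjective (fl f (p2 ≫ q1 ≫ e)) := by
    intro y
    obtain ⟨x, hx⟩ := P.surj (θ y)
    obtain ⟨x', hx'⟩ := Q.surj (g (θ y))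
    have h1 : ((x, x') : P.W × Q.W) ∈ (P.prod Q).pull g.graph :=
      (Pres.mem_pull _).2 ⟨(θ y, g (θ y)), rfl, hx, hx'⟩
    obtain ⟨w, hw⟩ := (hγ _).1 h1
    rw [hτ] at hw
    have hw1 := congrArg Prod.fst hw
    have hw2 := congrArg Prod.snd hw
    dsimp only at hw1 hw2
    obtain ⟨u, hu1, hu2⟩ := (hU _ _).1 hx
    obtain ⟨u', hu1', hu2'⟩ := (hU' _ _).1 hx'
    obtain ⟨z, hz1, hz2⟩ := H1 w u ((tau_bij f F P.c).1 (by rw [hu1, fl_comp, hw1]))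
    obtain ⟨z', hz1', hz2'⟩ := H2 z u' ((tau_bij f F Q.c).1 (by
      rw [hu1', fl_comp, fl_comp, hz1, hw2]))
    refine ⟨z', θ.injective ?_⟩
    rw [fl_comp, fl_comp, hz1', hz2, hu2]
  obtain ⟨φ, hφ⟩ := fl_desc f (p2 ≫ q1 ≫ e) (q2 ≫ e') hsurj (fun z hz => by
    apply θ'.injective
    rw [key, hz]; simp)
  refine ⟨φ, fun y => ?_⟩
  obtain ⟨z, rfl⟩ := hsurj y
  rw [← fl_comp, hφ, key]

end

theorem isLift_vertex (p : D) :
    IsLift f F (Pres.ofCtx (T := F ⋙q f.toPrefunctor) (Ctx.vertex p)) (F.obj p)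
      (LinearEquiv.refl R (f.obj (F.obj p))) := by
  refine ⟨F.obj p, 𝟙 _, 𝟙 _, fun x m => ⟨fun h => ?_, ?_⟩⟩
  · have h : m = x := h
    subst h
    exact ⟨m, fl_id f m, fl_id f m⟩
  · rintro ⟨u, rfl, rfl⟩
    rfl

variable {f F}

theorem isLift_iso {M : Type u} [AddCommGroup M] [Module R M]
    {P : Pres (F ⋙q f.toPrefunctor) M}
    {Y Y' : A} {θ : f.obj Y ≃ₗ[R] M} {θ' : f.obj Y' ≃ₗ[R] M}
    (hY : IsLift f F P Y θ) (hY' : IsLift f F P Y' θ') :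
    ∃ i : Y ≅ Y', ∀ y, θ' (fl f i.hom y) = θ y := by
  obtain ⟨φ, hφ⟩ := lift_hom hY hY' Tracked.id.isHom
  obtain ⟨ψ, hψ⟩ := lift_hom hY' hY Tracked.id.isHom
  refine ⟨⟨φ, ψ, ?_, ?_⟩, hφ⟩
  · apply fl_ext f
    intro y
    apply θ.injective
    rw [fl_comp, hψ, fl_id]
    exact hφ y
  · apply fl_ext f
    intro y
    apply θ'.injective
    rw [fl_comp, hφ, fl_id]
    exact hψ y

variable (f F)

theorem exists_L : ∃ L : Obj (F ⋙q f.toPrefunctor) ⥤ A,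
    IsFEL R L ∧ PrefunctorIso (Ttil (F ⋙q f.toPrefunctor) ⋙q L.toPrefunctor) F ∧
      Nonempty (L ⋙ f ≅ ff (F ⋙q f.toPrefunctor)) := by
  choose Y θ hY using fun X : Obj (F ⋙q f.toPrefunctor) => exists_isLift f F X.P
  choose φ hφ using fun (X X' : Obj (F ⋙q f.toPrefunctor)) (a : X ⟶ X') =>
    lift_hom (hY X) (hY X') (Obj.lin_isHom a)
  let L : Obj (F ⋙q f.toPrefunctor) ⥤ A :=
    { obj := Y
      map := fun {X X'} a => φ X X' a
      map_id := fun X => by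
        apply fl_ext f
        intro y
        apply (θ X).injective
        rw [hφ, fl_id]; rfl
      map_comp := fun {X X' X''} a b => by
        apply fl_ext f
        intro y
        apply (θ X'').injective
        rw [hφ, fl_comp, hφ, hφ]; rfl }
  have hL : ∀ {X X' : Obj (F ⋙q f.toPrefunctor)} (a : X ⟶ X') (y : f.obj (L.obj X)),
      θ X' (fl f (L.map a) y) = Obj.lin a (θ X y) := fun a y => hφ _ _ a y
  let η : L ⋙ f ≅ ff (F ⋙q f.toPrefunctor) :=
    NatIso.ofComponents (fun X => (θ X).toModuleIso) (fun {X X'} a => by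
      apply ModuleCat.hom_ext
      apply LinearMap.ext
      intro y
      exact hL a y)
  have hfaith : L.Faithful := by
    have : (L ⋙ f).Faithful := Functor.Faithful.of_iso η.symm
    exact Functor.Faithful.of_comp L f
  have hadd : L.Additive := ⟨fun {X X' a b} => by
    apply fl_ext f
    intro y
    apply (θ X').injective
    rw [hL, fl_add, map_add, hL, hL]; rfl⟩
  have hlin : L.Linear R := ⟨fun {X X'} a r => by
    apply fl_ext f
    intro y
    apply (θ X').injective
    rw [hL, fl_smul, map_smul, hL]; rfl⟩
  have := (ff_exact (T := F ⋙q f.toPrefunctor)).1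
  have := (ff_exact (T := F ⋙q f.toPrefunctor)).2
  have : PreservesFiniteLimits (L ⋙ f) := preservesFiniteLimits_of_natIso η.symm
  have : PreservesFiniteColimits (L ⋙ f) := preservesFiniteColimits_of_natIso η.symm
  have : f.ReflectsIsomorphisms := inferInstance
  have hl : PreservesFiniteLimits L := preservesFiniteLimits_of_reflects_of_preserves L f
  have hc : PreservesFiniteColimits L := preservesFiniteColimits_of_reflects_of_preserves L f
  refine ⟨L, ⟨hfaith, hl, hc, hadd, hlin⟩, ?_, ⟨η⟩⟩
  choose i hi using fun p : D =>
    isLift_iso (hY ((Ttil (F ⋙q f.toPrefunctor)).obj p)) (isLift_vertex f F p)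
  refine ⟨i, fun p q m => ?_⟩
  apply fl_ext f
  intro y
  rw [fl_comp, fl_comp]
  refine (hi q _).trans ((hL ((Ttil (F ⋙q f.toPrefunctor)).map m) y).trans ?_)
  exact congrArg (fl f (F.map m)) (hi p y).symm

/-- First projection between contexts. -/
def Obj.cfst {T : D ⥤q ModuleCat.{u} R} {M N : Type u} [AddCommGroup M] [Module R M]
    [AddCommGroup N] [Module R N] (c : Ctx T M) (d : Ctx T N) :
    Obj.ofCtx (c.prod d) ⟶ Obj.ofCtx c :=
  Obj.mk' (X := Obj.ofCtx (c.prod d)) (Y := Obj.ofCtx c) (LinearMap.fst R M N)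
    (Pres.tracked_ofCtx (Basic.fst c d)).isHom

/-- Second projection between contexts. -/
def Obj.csnd {T : D ⥤q ModuleCat.{u} R} {M N : Type u} [AddCommGroup M] [Module R M]
    [AddCommGroup N] [Module R N] (c : Ctx T M) (d : Ctx T N) :
    Obj.ofCtx (c.prod d) ⟶ Obj.ofCtx d :=
  Obj.mk' (X := Obj.ofCtx (c.prod d)) (Y := Obj.ofCtx d) (LinearMap.snd R M N)
    (Pres.tracked_ofCtx (Basic.snd c d)).isHom

theorem isLift_of_L (L : Obj (F ⋙q f.toPrefunctor) ⥤ A)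
    (hL : PrefunctorIso (Ttil (F ⋙q f.toPrefunctor) ⋙q L.toPrefunctor) F)
    (η : L ⋙ f ≅ ff (F ⋙q f.toPrefunctor)) :
    ∃ h : ∀ X : Obj (F ⋙q f.toPrefunctor), f.obj (L.obj X) ≃ₗ[R] X.M,
      (∀ X, IsLift f F X.P (L.obj X) (h X)) ∧
      ∀ {X X' : Obj (F ⋙q f.toPrefunctor)} (a : X ⟶ X') (y : f.obj (L.obj X)),
        h X' (fl f (L.map a) y) = Obj.lin a (h X y) := by
  obtain ⟨e, he⟩ := hL
  let H : ∀ X : Obj (F ⋙q f.toPrefunctor), f.obj (L.obj X) ≃ₗ[R] X.M :=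
    fun X => (η.app X).toLinearEquiv
  have hH : ∀ {X X' : Obj (F ⋙q f.toPrefunctor)} (a : X ⟶ X') (y : f.obj (L.obj X)),
      H X' (fl f (L.map a) y) = Obj.lin a (H X y) := fun a y =>
    LinearMap.congr_fun (congrArg ModuleCat.Hom.hom (η.hom.naturality a)) y
  have hH' : ∀ {X X' : Obj (F ⋙q f.toPrefunctor)} (a : X ⟶ X') (x : X.M),
      (H X').symm (Obj.lin a x) = fl f (L.map a) ((H X).symm x) := fun {X X'} a x => by
    rw [LinearEquiv.symm_apply_eq, hH, LinearEquiv.apply_symm_apply]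
  let S := Ttil (F ⋙q f.toPrefunctor)
  let e' : ∀ p : D, L.obj (S.obj p) ≅ F.obj p := e
  let Hv : ∀ p : D, f.obj (L.obj (S.obj p)) ≃ₗ[R] f.obj (F.obj p) := fun p => H (S.obj p)
  have hHv : ∀ ⦃p q : D⦄ (m : p ⟶ q) (x : f.obj (F.obj p)),
      (Hv q).symm (fl f (F.map m) x) = fl f (L.map (S.map m)) ((Hv p).symm x) :=
    fun p q m x => hH' (S.map m) x
  have he' : ∀ ⦃p q : D⦄ (m : p ⟶ q),
      L.map (S.map m) ≫ (e' q).hom = (e' p).hom ≫ F.map m := he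
  let α : ∀ p : D, f.obj (F.obj p) →ₗ[R] f.obj (F.obj p) := fun p =>
    fl f (e' p).hom ∘ₗ (Hv p).symm.toLinearMap
  let β : ∀ p : D, f.obj (F.obj p) →ₗ[R] f.obj (F.obj p) := fun p =>
    (Hv p).toLinearMap ∘ₗ fl f (e' p).inv
  have h1 : ∀ p x, β p (α p x) = x := fun p x => by
    show Hv p (fl f (e' p).inv (fl f (e' p).hom ((Hv p).symm x))) = x
    rw [← fl_comp, Iso.hom_inv_id, fl_id, LinearEquiv.apply_symm_apply]
  have h2 : ∀ p x, α p (β p x) = x := fun p x => by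
    show fl f (e' p).hom ((Hv p).symm (Hv p (fl f (e' p).inv x))) = x
    rw [LinearEquiv.symm_apply_apply, ← fl_comp, Iso.inv_hom_id, fl_id]
  have hα : ∀ ⦃p q : D⦄ (m : p ⟶ q) (x : f.obj (F.obj p)),
      fl f (F.map m) (α p x) = α q (fl f (F.map m) x) := fun p q m x => by
    show fl f (F.map m) (fl f (e' p).hom ((Hv p).symm x)) =
      fl f (e' q).hom ((Hv q).symm (fl f (F.map m) x))
    rw [hHv, ← fl_comp, ← fl_comp, he']
  have hβ : ∀ ⦃p q : D⦄ (m : p ⟶ q) (x : f.obj (F.obj p)),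
      fl f (F.map m) (β p x) = β q (fl f (F.map m) x) := fun p q m x => by
    have := hα m (β p x)
    rw [h2] at this
    rw [this, h1]
  choose E hE using fun X : Obj (F ⋙q f.toPrefunctor) =>
    exists_actEquiv (T := F ⋙q f.toPrefunctor) α β hα hβ h1 h2 X.P
  let h : ∀ X : Obj (F ⋙q f.toPrefunctor), f.obj (L.obj X) ≃ₗ[R] X.M := fun X => H X ≪≫ₗ E X
  have hn : ∀ {X X' : Obj (F ⋙q f.toPrefunctor)} (a : X ⟶ X') (y : f.obj (L.obj X)),
      h X' (fl f (L.map a) y) = Obj.lin a (h X y) := fun {X X'} a y => by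
    show E X' (H X' (fl f (L.map a) y)) = Obj.lin a (E X (H X y))
    rw [hH]
    exact (act_natural (T := F ⋙q f.toPrefunctor) α hα (E X).toLinearMap (E X').toLinearMap
      (hE X) (hE X') (Obj.lin a) (Obj.lin_isHom a) (H X y)).symm
  have hv : ∀ (p : D) (y : f.obj (L.obj (S.obj p))), h (S.obj p) y = fl f (e p).hom y := by
    intro p y
    have h3 : E (S.obj p) (H (S.obj p) y) = α p (H (S.obj p) y) := hE (S.obj p) _ _ rfl
    refine h3.trans ?_
    show fl f (e p).hom ((H (S.obj p)).symm (H (S.obj p) y)) = _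
    rw [LinearEquiv.symm_apply_apply]
  have hκ : ∀ {M : Type u} [AddCommGroup M] [Module R M] (c : Ctx (F ⋙q f.toPrefunctor) M),
      ∃ κ : L.obj (Obj.ofCtx c) ⟶ evA f F c,
        ∀ u, tau f F c (fl f κ u) = h (Obj.ofCtx c) u := by
    intro M _ _ c
    induction c with
    | zero => exact ⟨0, fun u => Subsingleton.elim (α := PUnit) _ _⟩
    | vertex p => exact ⟨(e p).hom, fun u => (hv p u).symm⟩
    | prod c d ih1 ih2 =>
      obtain ⟨κ₁, k1⟩ := ih1
      obtain ⟨κ₂, k2⟩ := ih2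
      let a1 : Obj.ofCtx (c.prod d) ⟶ Obj.ofCtx c :=
        Obj.cfst c d
      let a2 : Obj.ofCtx (c.prod d) ⟶ Obj.ofCtx d :=
        Obj.csnd c d
      refine ⟨biprod.lift (L.map a1 ≫ κ₁) (L.map a2 ≫ κ₂), fun u => Prod.ext ?_ ?_⟩
      · refine Eq.trans ?_ ((k1 (fl f (L.map a1) u)).trans (hn a1 u))
        refine congrArg (tau f F c) ?_
        refine (fl_comp f (biprod.lift (L.map a1 ≫ κ₁) (L.map a2 ≫ κ₂)) biprod.fst u).symm.trans ?_
        rw [biprod.lift_fst, fl_comp]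
      · refine Eq.trans ?_ ((k2 (fl f (L.map a2) u)).trans (hn a2 u))
        refine congrArg (tau f F d) ?_
        refine (fl_comp f (biprod.lift (L.map a1 ≫ κ₁) (L.map a2 ≫ κ₂)) biprod.snd u).symm.trans ?_
        rw [biprod.lift_snd, fl_comp]
  refine ⟨h, fun X => ?_, hn⟩
  obtain ⟨κ, k⟩ := hκ X.P.c
  let Z : Obj (F ⋙q f.toPrefunctor) := ((Obj.ofCtx X.P.c).prod X).sub X.P.rel X.P.defOn_rel
  let ι : Z ⟶ (Obj.ofCtx X.P.c).prod X := Obj.incl _ _ _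
  have q1 : ∀ u, tau f F X.P.c (fl f (L.map (ι ≫ Obj.fst _ _) ≫ κ) u) =
      Obj.lin (ι ≫ Obj.fst _ _) (h Z u) := fun u => by rw [fl_comp, k, hn]
  refine ⟨L.obj Z, L.map (ι ≫ Obj.fst _ _) ≫ κ, L.map (ι ≫ Obj.snd _ _), fun x m => ⟨?_, ?_⟩⟩
  · intro hx
    obtain ⟨u, hu⟩ := (h Z).surjective (⟨(x, m), hx⟩ : X.P.rel)
    refine ⟨u, ?_, ?_⟩
    · rw [q1, hu]; rfl
    · rw [hn, hu]; rfl
  · rintro ⟨u, rfl, rfl⟩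
    rw [q1, hn]
    exact ((h Z u : X.P.rel)).2

theorem unique_L (L L' : Obj (F ⋙q f.toPrefunctor) ⥤ A)
    (hL : PrefunctorIso (Ttil (F ⋙q f.toPrefunctor) ⋙q L.toPrefunctor) F)
    (η : L ⋙ f ≅ ff (F ⋙q f.toPrefunctor))
    (hL' : PrefunctorIso (Ttil (F ⋙q f.toPrefunctor) ⋙q L'.toPrefunctor) F)
    (η' : L' ⋙ f ≅ ff (F ⋙q f.toPrefunctor)) : Nonempty (L ≅ L') := by
  obtain ⟨h, h1, h2⟩ := isLift_of_L f F L hL η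
  obtain ⟨h', h1', h2'⟩ := isLift_of_L f F L' hL' η'
  choose i hi using fun X => isLift_iso (h1 X) (h1' X)
  refine ⟨NatIso.ofComponents i fun {X X'} a => ?_⟩
  apply fl_ext f
  intro y
  apply (h' X').injective
  rw [fl_comp, fl_comp, hi, h2, h2', hi]

end Lifts

end Nori

/-- **Nori.** For every representation `T` of a quiver `D` in finitely
generated modules over a commutative noetherian ring `R` there are an `R`-linear abelian
category `C(T)`, a representation `T̃ : D ⥤q C(T)` and a faithful exact `R`-linear
functor `ff_T : C(T) ⥤ R-Mod` with `ff_T ∘ T̃ = T`, such that for every `R`-linear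
abelian category `A` with a faithful exact `R`-linear functor `f : A ⥤ R-Mod` and every
representation `F : D ⥤q A` with `f ∘ F = T` there is a faithful exact `R`-linear
functor `L : C(T) ⥤ A`, unique up to natural isomorphism, with `L ∘ T̃ ≅ F` and
`f ∘ L ≅ ff_T`. -/
theorem stmt_0 {R : Type u} [CommRing R] [IsNoetherianRing R]
    {D : Type v} [Quiver.{w} D] (T : D ⥤q ModuleCat.{u} R)
    (hT : ∀ p : D, Module.Finite R (T.obj p)) :
    ∃ (𝒞 : RLinCat.{max u v, max (u + 1) v, u} R) (Ttil : D ⥤q 𝒞.carrier)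
      (ff : 𝒞.carrier ⥤ ModuleCat.{u} R),
      IsFEL R ff ∧
      Ttil ⋙q ff.toPrefunctor = T ∧
      ∀ (𝒜 : RLinCat.{b2, a2, u} R) (f : 𝒜.carrier ⥤ ModuleCat.{u} R)
        (F : D ⥤q 𝒜.carrier), IsFEL R f → F ⋙q f.toPrefunctor = T →
        ((∃ L : 𝒞.carrier ⥤ 𝒜.carrier,
            IsFEL R L ∧ PrefunctorIso (Ttil ⋙q L.toPrefunctor) F ∧
              Nonempty (L ⋙ f ≅ ff)) ∧
          ∀ (L L' : 𝒞.carrier ⥤ 𝒜.carrier),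
            IsFEL R L → PrefunctorIso (Ttil ⋙q L.toPrefunctor) F →
              Nonempty (L ⋙ f ≅ ff) →
            IsFEL R L' → PrefunctorIso (Ttil ⋙q L'.toPrefunctor) F →
              Nonempty (L' ⋙ f ≅ ff) →
            Nonempty (L ≅ L')) := by
  refine ⟨⟨Nori.Obj T⟩, Nori.Ttil T, Nori.ff T, Nori.ff_isFEL, Nori.Ttil_ff, ?_⟩
  intro 𝒜 f F hf hF
  subst hF
  obtain ⟨h1, h2, h3, h4, h5⟩ := hf
  have h6 : f.Linear R := h5
  refine ⟨Nori.exists_L f F, ?_⟩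
  rintro L L' - hL ⟨η⟩ - hL' ⟨η'⟩
  exact Nori.unique_L f F L L' hL η hL' η'
end

section
/- Let R be a commutative unital ring and A an R-module. Then the following are equivalent: (1) A is finitely generated and projective; (2) for every R-module N, the canonical R-linear map ρ^A_N : Dual_R(A) ⊗_R N → Hom_R(A, N), determined by φ ⊗ n ↦ (a ↦ φ(a) • n), is bijective. -/
universe u

/-- An `R`-module `A` is finitely generated and projective if and only
if for every `R`-module `N` the canonical map
`ρ^A_N = dualTensorHom : Dual R A ⊗[R] N →ₗ[R] (A →ₗ[R] N)`, `φ ⊗ n ↦ (a ↦ φ a • n)`,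
is bijective. -/
theorem stmt_12 {R : Type u} [CommRing R] (A : Type u) [AddCommGroup A] [Module R A] :
    (Module.Finite R A ∧ Module.Projective R A) ↔
      ∀ (N : Type u) [AddCommGroup N] [Module R N],
        Function.Bijective (dualTensorHom R A N) := by
  constructor
  · rintro ⟨h₁, h₂⟩ N _ _
    exact dualTensorHom_bijective
  · intro h
    have h1 : (1 : Module.End R A) ∈ LinearMap.range (dualTensorHom R A A) := (h A).2 1
    exact ⟨Module.Finite.of_one_mem_range_dualTensorHom h1,
      Module.Projective.of_one_mem_range_dualTensorHom h1⟩
end
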